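/- Let d > 0 be real, p a positive integer, and n ≥ 2 an integer with n > (2(p + d) + d)/d. Then the 3n×3n block matrix A has a positive real eigenvalue, namely μ₁ = −1 − d/p + (n−1)·d/(2p) > 0; in particular arg(μ₁) = 0, so the sector condition |arg(λ)| > απ/2 fails for some eigenvalue λ of A, for every α ∈ (0, 1]. -/

import Mathlib

/-- The diagonal block `A₀` of the linear part of the ring FMHNN system. -/
noncomputable def ringA0 (d : ℝ) (p : ℕ) : Matrix (Fin 3) (Fin 3) ℝ :=
  !![-1 - d / (p : ℝ), 0, 0;
     0, -1, 0;
     1, -1, 0]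

/-- The off-diagonal block `A₁` of the linear part of the ring FMHNN system. -/
noncomputable def ringA1 (d : ℝ) (p : ℕ) : Matrix (Fin 3) (Fin 3) ℝ :=
  !![d / (2 * (p : ℝ)), 0, 0;
     0, 0, 0;
     0, 0, 0]

/-- The `3n × 3n` block circulant matrix `bcirc(A₀, A₁, …, A₁)`, the linear part of the
ring FMHNN system with `n` sub-networks. -/
noncomputable def ringA (d : ℝ) (p n : ℕ) : Matrix (Fin n × Fin 3) (Fin n × Fin 3) ℝ :=
  fun q r => if q.1 = r.1 then ringA0 d p q.2 r.2 else ringA1 d p q.2 r.2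

/-- If `d > 0` and `n > (2(p + d) + d)/d`, then the ring matrix `A` has the positive real
eigenvalue `μ₁ = −1 − d/p + (n−1)·d/(2p) > 0`; in particular `arg μ₁ = 0`, so the sector
condition `|arg λ| > απ/2` fails for this eigenvalue, for every `α ∈ (0, 1]`. -/
theorem ringA_unstable_eigenvalue (d : ℝ) (hd : 0 < d) (p : ℕ) (hp : 1 ≤ p)
    (n : ℕ) (hn : 2 ≤ n) (hbound : (2 * ((p : ℝ) + d) + d) / d < (n : ℝ)) :
    0 < -1 - d / (p : ℝ) + ((n : ℝ) - 1) * d / (2 * (p : ℝ)) ∧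
      (ringA d p n).charpoly.IsRoot (-1 - d / (p : ℝ) + ((n : ℝ) - 1) * d / (2 * (p : ℝ))) ∧
      Complex.arg ((-1 - d / (p : ℝ) + ((n : ℝ) - 1) * d / (2 * (p : ℝ)) : ℝ) : ℂ) = 0 ∧
      ∀ α ∈ Set.Ioc (0 : ℝ) 1,
        ¬(|Complex.arg ((-1 - d / (p : ℝ) + ((n : ℝ) - 1) * d / (2 * (p : ℝ)) : ℝ) : ℂ)| >
            α * Real.pi / 2) := by
  have hp0 : (0 : ℝ) < p := by exact_mod_cast hp
  have hpos : 0 < -1 - d / (p : ℝ) + ((n : ℝ) - 1) * d / (2 * (p : ℝ)) := by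
    rw [div_lt_iff₀ hd] at hbound
    have : -1 - d / (p : ℝ) + ((n : ℝ) - 1) * d / (2 * (p : ℝ))
        = ((n : ℝ) * d - (2 * ((p : ℝ) + d) + d)) / (2 * (p : ℝ)) := by
      field_simp
      ring
    rw [this]
    apply div_pos <;> linarith
  have harg := Complex.arg_ofReal_of_nonneg hpos.le
  refine ⟨hpos, ?_, harg, ?_⟩
  · generalize hμ : -1 - d / (p : ℝ) + ((n : ℝ) - 1) * d / (2 * (p : ℝ)) = μ
    rw [Polynomial.IsRoot, Matrix.eval_charpoly]
    apply Matrix.exists_mulVec_eq_zero_iff.mp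
    refine ⟨fun q => ![μ, 0, 1] q.2, ?_, ?_⟩
    · intro h
      have := congrFun h (⟨0, by omega⟩, 2)
      simp at this
    · have key : ∀ (i : Fin n) (a b : ℝ),
          ∑ j : Fin n, (if i = j then a else b) = a + ((n : ℝ) - 1) * b := by
        intro i a b
        have : ∀ j : Fin n, (if i = j then a else b) = (if i = j then a - b else 0) + b := by
          intro j
          split_ifs <;> ring
        simp only [this, Finset.sum_add_distrib, Finset.sum_ite_eq, Finset.mem_univ, if_true,
          Finset.sum_const, Finset.card_univ, Fintype.card_fin, nsmul_eq_mul]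
        ring
      rw [Matrix.sub_mulVec, sub_eq_zero]
      ext ⟨i, k⟩
      have hl : (Matrix.scalar (Fin n × Fin 3) μ).mulVec
          (fun q => ![μ, 0, 1] q.2) (i, k) = μ * ![μ, 0, 1] k := by
        simp [Matrix.scalar_apply, Matrix.mulVec_diagonal]
      rw [hl]
      simp only [Matrix.mulVec, dotProduct, Fintype.sum_prod_type, Fin.sum_univ_three, ringA,
        Finset.sum_add_distrib, ← Finset.sum_mul, key]
      fin_cases k
      · simp [ringA0, ringA1]
        left
        rw [← hμ]
        ring
      · simp [ringA0, ringA1]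
      · simp [ringA0, ringA1]
  · intro α hα
    rw [harg, abs_zero]
    have := mul_pos hα.1 Real.pi_pos
    linarith
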